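/- arXiv:0911.1104 — 5 statements merged into one kernel-verified Lean document; each statement's English description precedes it below -/
import Mathlib

section
/- The Picard modular group SU(2,1;ℤ[i]) is generated by the four matrices N_{(0,i)}, N_{(1+i,1)}, M_i and J; that is, the subgroup of invertible 3×3 complex matrices generated by N_{(0,i)}, N_{(1+i,1)}, M_i, J is exactly the set of matrices G with Gaussian-integer entries satisfying Gᴴ C G = C and det G = 1. -/
open Matrix Complex

/-- The matrix `C` of the quadratic form defining the Siegel domain. -/
noncomputable def Cmat : Matrix (Fin 3) (Fin 3) ℂ := !![0,0,-1; 0,1,0; -1,0,0]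

/-- Membership in `SU(2,1)`: `Gᴴ C G = C` and `det G = 1`. -/
def inSU21 (G : Matrix (Fin 3) (Fin 3) ℂ) : Prop :=
  G.conjTranspose * Cmat * G = Cmat ∧ G.det = 1

/-- A complex number is a Gaussian integer. -/
def IsGaussianInt (z : ℂ) : Prop := ∃ m n : ℤ, z = (m : ℂ) + (n : ℂ) * Complex.I

/-- The Heisenberg translation matrix `N_a` for `a = (a₁, a₂) ∈ ℂ²`. -/
noncomputable def N (a : ℂ × ℂ) : Matrix (Fin 3) (Fin 3) ℂ :=
  !![1, 0, 0; a.1, 1, 0; a.2, star a.1, 1]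

/-- The rotation matrix `M_i = diag(i, -1, i)`. -/
noncomputable def Mi : Matrix (Fin 3) (Fin 3) ℂ :=
  !![Complex.I, 0, 0; 0, -1, 0; 0, 0, Complex.I]

/-- The involution `J`. -/
noncomputable def Jmat : Matrix (Fin 3) (Fin 3) ℂ := !![0, 0, -1; 0, -1, 0; -1, 0, 0]

/-- `N_{(0,i)}` as an element of `SL(3,ℂ)`. -/
noncomputable def N0i : Matrix.SpecialLinearGroup (Fin 3) ℂ :=
  ⟨N (0, Complex.I), by simp [N, Matrix.det_fin_three]⟩

/-- `N_{(1+i,1)}` as an element of `SL(3,ℂ)`. -/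
noncomputable def N1 : Matrix.SpecialLinearGroup (Fin 3) ℂ :=
  ⟨N (1 + Complex.I, 1), by simp [N, Matrix.det_fin_three]⟩

/-- `M_i` as an element of `SL(3,ℂ)`. -/
noncomputable def MiSL : Matrix.SpecialLinearGroup (Fin 3) ℂ :=
  ⟨Mi, by simp [Mi, Matrix.det_fin_three]⟩

/-- `J` as an element of `SL(3,ℂ)`. -/
noncomputable def JSL : Matrix.SpecialLinearGroup (Fin 3) ℂ :=
  ⟨Jmat, by simp [Jmat, Matrix.det_fin_three]⟩

/-- `N_{(0,i)}` as an invertible matrix. -/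
noncomputable def N0iGL : GL (Fin 3) ℂ := N0i.toGL
/-- `N_{(1+i,1)}` as an invertible matrix. -/
noncomputable def N1GL : GL (Fin 3) ℂ := N1.toGL
/-- `M_i` as an invertible matrix. -/
noncomputable def MiGL : GL (Fin 3) ℂ := MiSL.toGL
/-- `J` as an invertible matrix. -/
noncomputable def JGL : GL (Fin 3) ℂ := JSL.toGL

/-- The Gaussian integers, as a subring of `ℂ`. -/
noncomputable def gaussianSubring : Subring ℂ := GaussianInt.toComplex.range

theorem isGaussianInt_iff_mem {z : ℂ} : IsGaussianInt z ↔ z ∈ gaussianSubring := by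
  simp only [gaussianSubring, RingHom.mem_range, IsGaussianInt]
  constructor
  · rintro ⟨m, n, rfl⟩
    exact ⟨⟨m, n⟩, by simp [GaussianInt.toComplex_def]⟩
  · rintro ⟨w, rfl⟩
    exact ⟨w.re, w.im, by simp [GaussianInt.toComplex_def]⟩

theorem IsGaussianInt.star {z : ℂ} (h : IsGaussianInt z) : IsGaussianInt (star z) := by
  obtain ⟨m, n, rfl⟩ := h
  exact ⟨m, -n, by simp⟩

theorem Cmat_mul_self : Cmat * Cmat = 1 := by
  ext i j
  fin_cases i <;> fin_cases j <;> simp [Cmat, Matrix.mul_apply, Fin.sum_univ_three]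

theorem isGaussianInt_Cmat (i j : Fin 3) : IsGaussianInt (Cmat i j) := by
  rw [isGaussianInt_iff_mem]
  fin_cases i <;> fin_cases j <;> simp [Cmat, zero_mem, one_mem]

theorem isGaussianInt_mul {A B : Matrix (Fin 3) (Fin 3) ℂ} (hA : ∀ i j, IsGaussianInt (A i j))
    (hB : ∀ i j, IsGaussianInt (B i j)) (i j : Fin 3) : IsGaussianInt ((A * B) i j) := by
  simp only [isGaussianInt_iff_mem] at *
  rw [Matrix.mul_apply]
  exact sum_mem fun k _ => mul_mem (hA i k) (hB k j)

theorem inv_eq_of_conjTranspose_mul_Cmat_mul {g : GL (Fin 3) ℂ}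
    (h : (g : Matrix (Fin 3) (Fin 3) ℂ)ᴴ * Cmat * g = Cmat) :
    ((g⁻¹ : GL (Fin 3) ℂ) : Matrix (Fin 3) (Fin 3) ℂ)
      = Cmat * (g : Matrix (Fin 3) (Fin 3) ℂ)ᴴ * Cmat := by
  have h' : Cmat * (g : Matrix (Fin 3) (Fin 3) ℂ)ᴴ * Cmat * g = 1 := by
    rw [Matrix.mul_assoc, Matrix.mul_assoc, ← Matrix.mul_assoc _ Cmat, h, Cmat_mul_self]
  exact Units.inv_eq_of_mul_eq_one_left h'

/-- The Picard modular group as a subgroup of `GL(3,ℂ)`. -/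
def picardGroup : Subgroup (GL (Fin 3) ℂ) where
  carrier := {g | (∀ j k, IsGaussianInt ((g : Matrix (Fin 3) (Fin 3) ℂ) j k)) ∧
    inSU21 (g : Matrix (Fin 3) (Fin 3) ℂ)}
  one_mem' := by
    refine ⟨fun j k => ?_, by simp, by simp⟩
    rw [isGaussianInt_iff_mem, Units.val_one, Matrix.one_apply]
    split_ifs
    exacts [one_mem _, zero_mem _]
  mul_mem' := by
    rintro a b ⟨ha, ha', hda⟩ ⟨hb, hb', hdb⟩
    refine ⟨isGaussianInt_mul ha hb, ?_, by simp [hda, hdb]⟩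
    rw [Units.val_mul, conjTranspose_mul]
    calc _ = (b : Matrix (Fin 3) (Fin 3) ℂ)ᴴ * ((a : Matrix (Fin 3) (Fin 3) ℂ)ᴴ * Cmat * a) * b := by
          simp only [Matrix.mul_assoc]
      _ = _ := by rw [ha', hb']
  inv_mem' := by
    rintro g ⟨hg, hg', hd⟩
    refine ⟨fun j k => ?_, ?_, ?_⟩
    · rw [inv_eq_of_conjTranspose_mul_Cmat_mul hg']
      exact isGaussianInt_mul (isGaussianInt_mul isGaussianInt_Cmat fun i j => (hg j i).star)
        isGaussianInt_Cmat j k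
    · have h1 : (g : Matrix (Fin 3) (Fin 3) ℂ) * (g⁻¹ : GL (Fin 3) ℂ) = 1 := g.mul_inv
      have h2 : ((g⁻¹ : GL (Fin 3) ℂ) : Matrix (Fin 3) (Fin 3) ℂ)ᴴ *
          (g : Matrix (Fin 3) (Fin 3) ℂ)ᴴ = 1 := by
        rw [← conjTranspose_mul, h1, conjTranspose_one]
      calc _ = ((g⁻¹ : GL (Fin 3) ℂ) : Matrix (Fin 3) (Fin 3) ℂ)ᴴ *
            ((g : Matrix (Fin 3) (Fin 3) ℂ)ᴴ * Cmat * g) * (g⁻¹ : GL (Fin 3) ℂ) := by rw [hg']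
        _ = (((g⁻¹ : GL (Fin 3) ℂ) : Matrix (Fin 3) (Fin 3) ℂ)ᴴ *
            (g : Matrix (Fin 3) (Fin 3) ℂ)ᴴ) * Cmat *
            ((g : Matrix (Fin 3) (Fin 3) ℂ) * (g⁻¹ : GL (Fin 3) ℂ)) := by
          simp only [Matrix.mul_assoc]
        _ = Cmat := by rw [h1, h2, Matrix.one_mul, Matrix.mul_one]
    · have h1 : (g : Matrix (Fin 3) (Fin 3) ℂ).det *
          ((g⁻¹ : GL (Fin 3) ℂ) : Matrix (Fin 3) (Fin 3) ℂ).det = 1 := by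
        rw [← det_mul, g.mul_inv, det_one]
      rwa [hd, one_mul] at h1

/-- `N_a` as an invertible matrix. -/
noncomputable def NGL (a : ℂ × ℂ) : GL (Fin 3) ℂ :=
  SpecialLinearGroup.toGL ⟨N a, by simp [N, det_fin_three]⟩

@[simp] theorem coe_NGL (a : ℂ × ℂ) : (NGL a : Matrix (Fin 3) (Fin 3) ℂ) = N a := rfl

@[simp] theorem coe_MiGL : (MiGL : Matrix (Fin 3) (Fin 3) ℂ) = Mi := rfl

@[simp] theorem coe_JGL : (JGL : Matrix (Fin 3) (Fin 3) ℂ) = Jmat := rfl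

theorem NGL_mul (a b : ℂ × ℂ) :
    NGL a * NGL b = NGL (a.1 + b.1, a.2 + star a.1 * b.1 + b.2) := by
  apply Units.ext
  ext i j
  fin_cases i <;> fin_cases j <;> simp [N, Matrix.mul_apply, Fin.sum_univ_three, add_comm]

theorem NGL_zero : NGL (0, 0) = 1 := by
  apply Units.ext
  ext i j
  fin_cases i <;> fin_cases j <;> simp [N]

/-- The subgroup generated by `N_{(0,i)}`, `N_{(1+i,1)}`, `M_i` and `J`. -/
noncomputable def generatedGroup : Subgroup (GL (Fin 3) ℂ) :=
  Subgroup.closure {N0iGL, N1GL, MiGL, JGL}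

theorem NGL_zero_I_mem : NGL (0, I) ∈ generatedGroup :=
  Subgroup.subset_closure (Or.inl rfl)

theorem NGL_one_add_I_mem : NGL (1 + I, 1) ∈ generatedGroup :=
  Subgroup.subset_closure (Or.inr (Or.inl rfl))

theorem MiGL_mem : MiGL ∈ generatedGroup :=
  Subgroup.subset_closure (Or.inr (Or.inr (Or.inl rfl)))

theorem JGL_mem : JGL ∈ generatedGroup :=
  Subgroup.subset_closure (Or.inr (Or.inr (Or.inr rfl)))

theorem NGL_mem_picardGroup {a : ℂ × ℂ} (h₁ : IsGaussianInt a.1) (h₂ : IsGaussianInt a.2)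
    (h : a.2 + star a.2 = star a.1 * a.1) : NGL a ∈ picardGroup := by
  refine ⟨fun i j => ?_, ?_, by simp [N, det_fin_three]⟩
  · have h₃ := h₁.star
    rw [isGaussianInt_iff_mem] at *
    fin_cases i <;> fin_cases j <;> simp [N, zero_mem, one_mem] <;> assumption
  · ext i j
    simp only [star_def] at h
    fin_cases i <;> fin_cases j <;>
      simp [N, Cmat, Matrix.mul_apply, Fin.sum_univ_three]
    linear_combination -h

theorem generatedGroup_le_picardGroup : generatedGroup ≤ picardGroup := by
  refine (Subgroup.closure_le _).2 ?_
  rintro g (rfl | rfl | rfl | rfl)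
  · exact NGL_mem_picardGroup (a := (0, I)) ⟨0, 0, by simp⟩ ⟨0, 1, by simp⟩ (by simp)
  · refine NGL_mem_picardGroup (a := (1 + I, 1)) ⟨1, 1, by simp⟩ ⟨1, 0, by simp⟩ ?_
    simp
    linear_combination I_mul_I
  · refine ⟨fun i j => ?_, ?_, Matrix.SpecialLinearGroup.det_coe _⟩
    · have hI : I ∈ gaussianSubring := isGaussianInt_iff_mem.1 ⟨0, 1, by simp⟩
      rw [isGaussianInt_iff_mem]
      fin_cases i <;> fin_cases j <;> simp [Mi, zero_mem, one_mem, hI]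
    · ext i j
      fin_cases i <;> fin_cases j <;> simp [Mi, Cmat, Matrix.mul_apply, Fin.sum_univ_three]
  · refine ⟨fun i j => ?_, ?_, Matrix.SpecialLinearGroup.det_coe _⟩
    · rw [isGaussianInt_iff_mem]
      fin_cases i <;> fin_cases j <;> simp [Jmat, zero_mem, one_mem]
    · ext i j
      fin_cases i <;> fin_cases j <;> simp [Jmat, Cmat, Matrix.mul_apply, Fin.sum_univ_three]

/-- The vertical Heisenberg translations `N_{(0,t)}`, as a homomorphism. -/
noncomputable def verticalHom : Multiplicative ℂ →* GL (Fin 3) ℂ where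
  toFun t := NGL (0, t.toAdd)
  map_one' := NGL_zero
  map_mul' s t := by simp [NGL_mul]

theorem NGL_zero_int_mul_I_mem (n : ℤ) : NGL (0, n * I) ∈ generatedGroup := by
  have h : verticalHom (Multiplicative.ofAdd I ^ n) ∈ generatedGroup := by
    rw [map_zpow]
    exact zpow_mem NGL_zero_I_mem n
  rw [← ofAdd_zsmul, zsmul_eq_mul] at h
  exact h

/-- The horizontal parts `a₁` of the Heisenberg translations `N_{(a₁,a₂)}` in the generated
group. -/
noncomputable def horizontalParts : AddSubgroup ℂ where
  carrier := {z | ∃ w, NGL (z, w) ∈ generatedGroup}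
  zero_mem' := ⟨I, NGL_zero_I_mem⟩
  add_mem' := by
    rintro z z' ⟨w, hw⟩ ⟨w', hw'⟩
    exact ⟨_, NGL_mul (z, w) (z', w') ▸ mul_mem hw hw'⟩
  neg_mem' := by
    rintro z ⟨w, hw⟩
    refine ⟨star z * z - w, ?_⟩
    have h : (NGL (z, w))⁻¹ = NGL (-z, star z * z - w) := by
      rw [inv_eq_iff_mul_eq_one, NGL_mul, ← NGL_zero]
      congr 2
      · simp
      · simp; ring
    exact h ▸ inv_mem hw

theorem one_add_I_mul_mem_horizontalParts (m n : ℤ) :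
    (1 + I) * (m + n * I) ∈ horizontalParts := by
  have h₁ : 1 + I ∈ horizontalParts := ⟨1, NGL_one_add_I_mem⟩
  have h₂ : I * (1 + I) ∈ horizontalParts := by
    refine ⟨1, ?_⟩
    have h : NGL (I * (1 + I), 1) = MiGL * NGL (1 + I, 1) * MiGL⁻¹ := by
      rw [eq_mul_inv_iff_mul_eq]
      apply Units.ext
      ext i j
      fin_cases i <;> fin_cases j <;> simp [N, Mi, Matrix.mul_apply, Fin.sum_univ_three]
      all_goals linear_combination (1 + I) * I_mul_I
    rw [h]
    exact mul_mem (mul_mem MiGL_mem NGL_one_add_I_mem) (inv_mem MiGL_mem)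
  have h := add_mem (zsmul_mem h₁ m) (zsmul_mem h₂ n)
  rw [zsmul_eq_mul, zsmul_eq_mul] at h
  convert h using 1
  ring

theorem re_form_eq_of_NGL_mem_picardGroup {a : ℂ × ℂ} (h : NGL a ∈ picardGroup) :
    a.2 + star a.2 = star a.1 * a.1 := by
  have := congrFun₂ h.2.1 0 0
  simp [N, Cmat, Matrix.mul_apply, Fin.sum_univ_three] at this ⊢
  linear_combination -this

theorem NGL_mem_generatedGroup {a : ℂ × ℂ} (h : NGL a ∈ picardGroup) :
    NGL a ∈ generatedGroup := by
  obtain ⟨z, t⟩ := a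
  have hz : IsGaussianInt z := h.1 1 0
  have ht : IsGaussianInt t := h.1 2 0
  have hf := re_form_eq_of_NGL_mem_picardGroup h
  obtain ⟨p, q, rfl⟩ := hz
  obtain ⟨r, s, rfl⟩ := ht
  have hpq : 2 * r = p * p + q * q := by
    have := congrArg re hf
    simp at this
    have h' : (2 * r : ℝ) = p * p + q * q := by linarith
    exact_mod_cast h'
  obtain ⟨k, hk⟩ : Even (p + q) := by
    have : Even (p * p + q * q) := ⟨r, by linarith⟩
    simpa [Int.even_add, Int.even_mul] using this
  obtain ⟨w, hw⟩ := one_add_I_mul_mem_horizontalParts k (q - k)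
  have hz : (1 + I) * ((k : ℂ) + ((q - k : ℤ) : ℂ) * I) = p + q * I := by
    have hk' : (p + q : ℂ) = k + k := by exact_mod_cast hk
    push_cast
    linear_combination (-hk') + (q - k) * I_mul_I
  rw [hz] at hw
  have hw' := generatedGroup_le_picardGroup hw
  have hf' := re_form_eq_of_NGL_mem_picardGroup hw'
  obtain ⟨r', s', rfl⟩ : IsGaussianInt w := hw'.1 2 0
  have hr : (r : ℂ) = r' := by
    have := hf.trans hf'.symm
    simp at this
    linear_combination this / 2
  have h' := mul_mem (NGL_zero_int_mul_I_mem (s - s')) hw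
  rw [NGL_mul] at h'
  convert h' using 3
  · simp
  · simp [hr]; ring

theorem mem_generatedGroup_of_unipotent {g : GL (Fin 3) ℂ} (hg : g ∈ picardGroup)
    (h₀ : g 0 2 = 0) (h₂ : g 2 2 = 1) : g ∈ generatedGroup := by
  have form (i j : Fin 3) := congrFun₂ hg.2.1 i j
  simp only [Matrix.mul_apply, Fin.sum_univ_three, conjTranspose_apply, star_def] at form
  have h₁ : g 1 2 = 0 := by simpa [Cmat, h₀] using form 2 2
  have h₀₁ : g 0 1 = 0 := by simpa [Cmat, h₀, h₁, h₂] using form 1 2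
  have h₀₀ : g 0 0 = 1 := by simpa [Cmat, h₀, h₁, h₂] using form 2 0
  have h₁₁ : g 1 1 = 1 := by simpa [det_fin_three, h₀, h₁, h₂, h₀₁, h₀₀] using hg.2.2
  have h₂₁ : g 2 1 = star (g 1 0) := by
    have := form 0 1
    simp [Cmat, h₀₁, h₀₀, h₁₁] at this ⊢
    linear_combination -this
  have h : g = NGL (g 1 0, g 2 0) := by
    apply Units.ext
    ext i j
    fin_cases i <;> fin_cases j <;> simp [N, *]
  rw [h] at hg ⊢
  exact NGL_mem_generatedGroup hg

theorem mem_generatedGroup_of_mul_MiGL {g : GL (Fin 3) ℂ} (hg : g * MiGL ∈ generatedGroup) :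
    g ∈ generatedGroup :=
  (Subgroup.mul_mem_cancel_right _ MiGL_mem).1 hg

theorem mul_MiGL_apply_two (g : GL (Fin 3) ℂ) (i : Fin 3) : (g * MiGL) i 2 = g i 2 * I := by
  simp [Mi, Matrix.mul_apply, Fin.sum_univ_three]

theorem IsGaussianInt.eq_of_normSq_eq_one {z : ℂ} (hz : IsGaussianInt z) (h : normSq z = 1) :
    z = 1 ∨ z = -I ∨ z = -1 ∨ z = I := by
  obtain ⟨m, n, rfl⟩ := hz
  simp [normSq_apply] at h
  have h' : m * m + n * n = 1 := by exact_mod_cast h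
  have hm : -1 ≤ m ∧ m ≤ 1 := by constructor <;> nlinarith
  have hn : -1 ≤ n ∧ n ≤ 1 := by constructor <;> nlinarith
  obtain ⟨hm₁, hm₂⟩ := hm
  obtain ⟨hn₁, hn₂⟩ := hn
  interval_cases m <;> interval_cases n <;> simp at h' ⊢

theorem IsGaussianInt.one_le_normSq {z : ℂ} (hz : IsGaussianInt z) (h : z ≠ 0) :
    1 ≤ normSq z := by
  have h₀ := normSq_pos.2 h
  obtain ⟨m, n, rfl⟩ := hz
  simp [normSq_apply] at h₀ ⊢
  have h' : 0 < m * m + n * n := by exact_mod_cast h₀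
  exact_mod_cast h'

theorem mem_generatedGroup_of_triangular {g : GL (Fin 3) ℂ} (hg : g ∈ picardGroup)
    (h₀ : g 0 2 = 0) : g ∈ generatedGroup := by
  have form (i j : Fin 3) := congrFun₂ hg.2.1 i j
  simp only [Matrix.mul_apply, Fin.sum_univ_three, conjTranspose_apply, star_def] at form
  have h₁ : g 1 2 = 0 := by simpa [Cmat, h₀] using form 2 2
  have h₂ : (starRingEnd ℂ) (g 0 0) * g 2 2 = 1 := by simpa [Cmat, h₀, h₁] using form 0 2
  have hn : normSq (g 0 0) * normSq (g 2 2) = 1 := by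
    simpa using congrArg normSq h₂
  have h00 : g 0 0 ≠ 0 := by rintro h; simp [h] at h₂
  have h22 : g 2 2 ≠ 0 := by rintro h; simp [h] at h₂
  have hunit : normSq (g 2 2) = 1 := by
    nlinarith [(hg.1 0 0).one_le_normSq h00, (hg.1 2 2).one_le_normSq h22]
  have hM := generatedGroup_le_picardGroup MiGL_mem
  have step (u : ℂ)
      (ih : ∀ g ∈ picardGroup, g 0 2 = 0 → g 2 2 = u * I → g ∈ generatedGroup) :
      ∀ g ∈ picardGroup, g 0 2 = 0 → g 2 2 = u → g ∈ generatedGroup := fun g hg h₀ h₂ =>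
    mem_generatedGroup_of_mul_MiGL <| ih _ (mul_mem hg hM)
      (by rw [mul_MiGL_apply_two, h₀, zero_mul]) (by rw [mul_MiGL_apply_two, h₂])
  have hone : ∀ g ∈ picardGroup, g 0 2 = 0 → g 2 2 = 1 → g ∈ generatedGroup :=
    fun g => mem_generatedGroup_of_unipotent
  have hnegI := step (-I) (by simpa using hone)
  have hneg := step (-1) (by simpa using hnegI)
  have hI := step I (by simpa using hneg)
  rcases (hg.1 2 2).eq_of_normSq_eq_one hunit with h | h | h | h
  exacts [hone g hg h₀ h, hnegI g hg h₀ h, hneg g hg h₀ h, hI g hg h₀ h]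

/-- Every point `(z, w)` of the boundary of the Siegel domain can be moved by an integral Heisenberg
translation to one whose last coordinate has squared modulus at most `1/2`. -/
theorem exists_NGL_normSq_le_half {z w : ℂ} (h : 2 * w.re = normSq z) :
    ∃ a : ℂ × ℂ, NGL a ∈ generatedGroup ∧
      normSq (a.2 + star a.1 * z + w) ≤ 1 / 2 := by
  set x := (z.re + z.im) / 2
  set y := (z.im - z.re) / 2
  set m := round x
  set n := round y
  set a₁ : ℂ := (1 + I) * ((-m : ℤ) + (-n : ℤ) * I) with ha₁
  set k := round (star a₁ * z + w).im
  refine ⟨(a₁, ((m * m + n * n : ℤ) : ℂ) + ((-k : ℤ) : ℂ) * I), ?_, ?_⟩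
  · refine NGL_mem_generatedGroup (NGL_mem_picardGroup ?_ ⟨_, _, rfl⟩ ?_)
    · exact ⟨n - m, -m - n, by simp [ha₁]; linear_combination (-n : ℂ) * I_mul_I⟩
    · simp [ha₁]
      linear_combination ((m : ℂ) * m + n * n + n * n * (1 - I * I)) * I_mul_I
  · have hxm := abs_le.1 (abs_sub_round x)
    have hyn := abs_le.1 (abs_sub_round y)
    have hik := abs_le.1 (abs_sub_round (star a₁ * z + w).im)
    have hre : ((((m * m + n * n : ℤ) : ℂ) + ((-k : ℤ) : ℂ) * I) + star a₁ * z + w).re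
        = (x - m) ^ 2 + (y - n) ^ 2 := by
      rw [normSq_apply] at h
      simp [ha₁]
      linear_combination h / 2
    have him : ((((m * m + n * n : ℤ) : ℂ) + ((-k : ℤ) : ℂ) * I) + star a₁ * z + w).im
        = (star a₁ * z + w).im - k := by
      simp; ring
    rw [normSq_apply, hre, him]
    have h₁ : (x - m) ^ 2 ≤ 1 / 4 := by nlinarith
    have h₂ : (y - n) ^ 2 ≤ 1 / 4 := by nlinarith
    have h₃ : ((star a₁ * z + w).im - k) * ((star a₁ * z + w).im - k) ≤ 1 / 4 := by nlinarith
    nlinarith [sq_nonneg (x - m), sq_nonneg (y - n)]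

theorem exists_descent {g : GL (Fin 3) ℂ} (hg : g ∈ picardGroup) (h₀ : g 0 2 ≠ 0) :
    ∃ s ∈ generatedGroup, normSq ((s * g) 0 2) ≤ normSq (g 0 2) / 2 := by
  have hform := congrFun₂ hg.2.1 2 2
  have hzw : 2 * (g 2 2 / g 0 2).re = normSq (g 1 2 / g 0 2) := by
    simp only [Matrix.mul_apply, Fin.sum_univ_three, conjTranspose_apply, star_def] at hform
    simp [Cmat] at hform
    have h₁ := congrArg re hform
    have hn := (normSq_pos.2 h₀).ne'
    simp at h₁
    rw [normSq_div, div_re]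
    field_simp
    rw [normSq_apply (g 1 2)]
    linear_combination -h₁
  obtain ⟨a, ha, hle⟩ := exists_NGL_normSq_le_half hzw
  refine ⟨JGL * NGL a, mul_mem JGL_mem ha, ?_⟩
  have h : (JGL * NGL a * g) 0 2
      = -(g 0 2 * (a.2 + star a.1 * (g 1 2 / g 0 2) + g 2 2 / g 0 2)) := by
    simp [Jmat, N, Matrix.mul_apply, Fin.sum_univ_three]
    field_simp
    ring
  rw [h, normSq_neg, normSq_mul]
  nlinarith [normSq_nonneg (g 0 2)]

theorem mem_generatedGroup_of_normSq_lt (n : ℕ) :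
    ∀ g ∈ picardGroup, normSq (g 0 2) < 2 ^ n → g ∈ generatedGroup := by
  induction n with
  | zero =>
    intro g hg h
    refine mem_generatedGroup_of_triangular hg (by_contra fun h₀ => ?_)
    linarith [(hg.1 0 2).one_le_normSq h₀]
  | succ n ih =>
    intro g hg h
    by_cases h₀ : g 0 2 = 0
    · exact mem_generatedGroup_of_triangular hg h₀
    obtain ⟨s, hs, hle⟩ := exists_descent hg h₀
    refine (Subgroup.mul_mem_cancel_left _ hs).1
      (ih _ (mul_mem (generatedGroup_le_picardGroup hs) hg) ?_)
    rw [pow_succ] at h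
    linarith

theorem generatedGroup_eq_picardGroup : generatedGroup = picardGroup := by
  refine le_antisymm generatedGroup_le_picardGroup fun g hg => ?_
  obtain ⟨n, hn⟩ := pow_unbounded_of_one_lt (normSq (g 0 2)) one_lt_two
  exact mem_generatedGroup_of_normSq_lt n g hg hn

/-- The Picard modular group `SU(2,1;ℤ[i])` is generated by `N_{(0,i)}`, `N_{(1+i,1)}`,
`M_i` and `J`. -/
theorem picard_modular_group_generators (G : Matrix (Fin 3) (Fin 3) ℂ) :
    (∃ g ∈ Subgroup.closure ({N0iGL, N1GL, MiGL, JGL} : Set (GL (Fin 3) ℂ)),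
        (g : Matrix (Fin 3) (Fin 3) ℂ) = G) ↔
      ((∀ j k, IsGaussianInt (G j k)) ∧ G.conjTranspose * Cmat * G = Cmat ∧ G.det = 1) := by
  change (∃ g ∈ generatedGroup, _) ↔ _
  rw [generatedGroup_eq_picardGroup]
  constructor
  · rintro ⟨g, hg, rfl⟩
    exact hg
  · intro h
    exact ⟨SpecialLinearGroup.toGL ⟨G, h.2.2⟩, h, rfl⟩
end

section
/- Let G = (g_{jk}) be a 3×3 complex matrix in SU(2,1). If g_{13} = 0, then G is lower triangular, i.e. g_{12} = g_{13} = g_{23} = 0. -/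
open Matrix Complex

/-- If `G ∈ SU(2,1)` and `g₁₃ = 0` then `G` is lower triangular. -/
theorem lowerTriangular_of_entry13_eq_zero (G : Matrix (Fin 3) (Fin 3) ℂ)
    (hG : inSU21 G) (h13 : G 0 2 = 0) :
    G 0 1 = 0 ∧ G 0 2 = 0 ∧ G 1 2 = 0 := by
  have entry (j k : Fin 3) := congrFun (congrFun hG.1 j) k
  have h12 : G 1 2 = 0 := by
    simpa [Cmat, Matrix.mul_apply, Fin.sum_univ_three, h13] using entry 2 2
  have h22 : G 2 2 ≠ 0 := by
    intro h
    simpa [Cmat, Matrix.mul_apply, Fin.sum_univ_three, h13, h12, h] using entry 0 2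
  refine ⟨?_, h13, h12⟩
  simpa [Cmat, Matrix.mul_apply, Fin.sum_univ_three, h13, h12, h22] using entry 1 2
end

section
/- Let k, l, r be integers and set γ = k(1+i) + l(−1+i). Then the matrix N_{(γ, ½|γ|² + i r)} equals the product N_{(0,i)}^{r−2kl} · N_{(1+i,1)}^k · M_i · N_{(1+i,1)}^l · M_i⁻¹. -/
open Matrix Complex

theorem N_mul_N (a b : ℂ × ℂ) :
    N a * N b = N (a.1 + b.1, a.2 + star a.1 * b.1 + b.2) := by
  ext i j
  fin_cases i <;> fin_cases j <;> simp [N, Matrix.mul_apply, Fin.sum_univ_three]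

theorem N_zero : N (0, 0) = 1 := by
  ext i j
  fin_cases i <;> fin_cases j <;> simp [N]

theorem coe_inv_eq_N {U : GL (Fin 3) ℂ} {a b : ℂ}
    (hU : (U : Matrix (Fin 3) (Fin 3) ℂ) = N (a, b)) :
    ((U⁻¹ : GL (Fin 3) ℂ) : Matrix (Fin 3) (Fin 3) ℂ) = N (-a, -b + star a * a) := by
  refine Units.inv_eq_of_mul_eq_one_right ?_
  rw [hU, N_mul_N, ← N_zero]
  congr 2 <;> ring

theorem coe_zpow_eq_N {U : GL (Fin 3) ℂ} {a b : ℂ}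
    (hU : (U : Matrix (Fin 3) (Fin 3) ℂ) = N (a, b)) (n : ℤ) :
    ((U ^ n : GL (Fin 3) ℂ) : Matrix (Fin 3) (Fin 3) ℂ) =
      N (n * a, n * b + n * (n - 1) / 2 * (star a * a)) := by
  induction n with
  | zero => simp [N_zero]
  | succ n ih =>
    rw [_root_.zpow_add_one, Units.val_mul, ih, hU, N_mul_N]
    congr 2 <;> simp <;> ring
  | pred n ih =>
    rw [_root_.zpow_sub_one, Units.val_mul, ih, coe_inv_eq_N hU, N_mul_N]
    congr 2 <;> simp <;> ring

theorem coe_MiGL_inv :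
    ((MiGL⁻¹ : GL (Fin 3) ℂ) : Matrix (Fin 3) (Fin 3) ℂ) =
      !![-Complex.I, 0, 0; 0, -1, 0; 0, 0, -Complex.I] := by
  refine Units.inv_eq_of_mul_eq_one_right ?_
  change Mi * _ = 1
  ext i j
  fin_cases i <;> fin_cases j <;> simp [Mi, Matrix.mul_apply, Fin.sum_univ_three]

theorem Mi_mul_N_mul_inv (a b : ℂ) :
    Mi * N (a, b) * ((MiGL⁻¹ : GL (Fin 3) ℂ) : Matrix (Fin 3) (Fin 3) ℂ) =
      N (Complex.I * a, b) := by
  rw [coe_MiGL_inv]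
  ext i j
  fin_cases i <;> fin_cases j <;>
    simp [Mi, N, Matrix.mul_apply, Fin.sum_univ_three] <;> ring_nf <;> simp

/-- Decomposition of `N_{(γ, ½|γ|² + i r)}` for `γ = k(1+i) + l(-1+i)` as a product of
the generators. -/
theorem N_gamma_as_product_of_generators (k l r : ℤ) :
    N ((k : ℂ) * (1 + Complex.I) + (l : ℂ) * (-1 + Complex.I),
        ((k : ℂ) * (1 + Complex.I) + (l : ℂ) * (-1 + Complex.I)) *
            star ((k : ℂ) * (1 + Complex.I) + (l : ℂ) * (-1 + Complex.I)) / 2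
          + (r : ℂ) * Complex.I)
      = ((N0iGL ^ (r - 2 * k * l) * N1GL ^ k * MiGL * N1GL ^ l * MiGL⁻¹ :
            GL (Fin 3) ℂ) : Matrix (Fin 3) (Fin 3) ℂ) := by
  have hMi : (MiGL : Matrix (Fin 3) (Fin 3) ℂ) = Mi := rfl
  rw [mul_assoc, mul_assoc, ← mul_assoc MiGL, Units.val_mul, Units.val_mul, Units.val_mul,
    Units.val_mul, hMi, coe_zpow_eq_N (a := 0) (b := Complex.I) rfl,
    coe_zpow_eq_N (U := N1GL) (a := 1 + Complex.I) (b := 1) rfl,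
    coe_zpow_eq_N (U := N1GL) (a := 1 + Complex.I) (b := 1) rfl,
    Mi_mul_N_mul_inv, N_mul_N, N_mul_N]
  congr 2
  · linear_combination (-l : ℂ) * Complex.I_sq
  · simp
    ring_nf
    simp only [Complex.I_sq, Complex.I_pow_three]
    ring
end

section
/- Let G = (g_{jk}) ∈ SU(2,1) with g_{13} ≠ 0, and set a = (g_{23}/g_{13}, g_{33}/g_{13}). Then the matrix P = J · N_a⁻¹ · G is lower triangular, so that G = N_a · J · P with P lower triangular; moreover the first row of G is the negative of the third row of P, i.e. g_{1j} = −p_{3j} for j = 1,2,3. -/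
open Matrix Complex

/-- The Heisenberg translation `N_a` has determinant one. -/
lemma det_N (a : ℂ × ℂ) : (N a).det = 1 := by
  simp [N, Matrix.det_fin_three]

/-- The inverse of `N_a`. -/
lemma inv_N (a : ℂ × ℂ) :
    (N a)⁻¹ = !![1, 0, 0; -a.1, 1, 0; a.1 * star a.1 - a.2, -star a.1, 1] := by
  refine Matrix.inv_eq_right_inv ?_
  ext i j
  fin_cases i <;> fin_cases j <;> simp [N, Matrix.mul_apply, Fin.sum_univ_three]
  ring

/-- The matrix `J` is an involution. -/
lemma Jmat_mul_self : Jmat * Jmat = 1 := by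
  ext i j
  fin_cases i <;> fin_cases j <;> simp [Jmat, Matrix.mul_apply, Fin.sum_univ_three]

/-- The columns of an element of `SU(2,1)` have the Gram matrix `C`. -/
lemma inSU21.form_columns {G : Matrix (Fin 3) (Fin 3) ℂ} (hG : inSU21 G) (j k : Fin 3) :
    -(star (G 2 j) * G 0 k) + star (G 1 j) * G 1 k - star (G 0 j) * G 2 k = Cmat j k := by
  rw [← hG.1]
  simp [Cmat, Matrix.mul_apply, Fin.sum_univ_three]
  ring

/-- For `G ∈ SU(2,1)` with `g₁₃ ≠ 0` and `a = (g₂₃/g₁₃, g₃₃/g₁₃)`, the matrix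
`P = J N_a⁻¹ G` is lower triangular, `G = N_a J P`, and `g₁ⱼ = -p₃ⱼ`. -/
theorem decomposition_NJP (G : Matrix (Fin 3) (Fin 3) ℂ)
    (hG : inSU21 G) (h13 : G 0 2 ≠ 0) :
    ∀ P : Matrix (Fin 3) (Fin 3) ℂ,
      P = Jmat * (N (G 1 2 / G 0 2, G 2 2 / G 0 2))⁻¹ * G →
        (P 0 1 = 0 ∧ P 0 2 = 0 ∧ P 1 2 = 0) ∧
        G = N (G 1 2 / G 0 2, G 2 2 / G 0 2) * Jmat * P ∧
        (∀ j : Fin 3, G 0 j = -P 2 j) := by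
  rintro P rfl
  set a : ℂ × ℂ := (G 1 2 / G 0 2, G 2 2 / G 0 2)
  have hs : star (G 0 2) ≠ 0 := star_ne_zero.mpr h13
  have h1 : G 1 2 = a.1 * G 0 2 := (div_mul_cancel₀ _ h13).symm
  have h2 : G 2 2 = a.2 * G 0 2 := (div_mul_cancel₀ _ h13).symm
  have isotropic : a.1 * star a.1 - a.2 = star a.2 := by
    have h := hG.form_columns 2 2
    rw [h1, h2, star_mul', star_mul'] at h
    simp only [Cmat, Matrix.of_apply, Matrix.cons_val] at h
    refine mul_left_cancel₀ (mul_ne_zero hs h13) ?_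
    linear_combination h
  have orthogonal : star a.2 * G 0 1 - star a.1 * G 1 1 + G 2 1 = 0 := by
    have h := hG.form_columns 2 1
    rw [h1, h2, star_mul', star_mul'] at h
    simp only [Cmat, Matrix.of_apply, Matrix.cons_val] at h
    refine mul_left_cancel₀ hs ?_
    linear_combination -h
  clear_value a
  refine ⟨⟨?_, ?_, ?_⟩, ?_, fun j => ?_⟩
  · rw [inv_N, isotropic]
    simp [Jmat, Matrix.mul_apply, Fin.sum_univ_three]
    simp at orthogonal
    linear_combination -orthogonal
  · rw [inv_N]
    simp [Jmat, Matrix.mul_apply, Fin.sum_univ_three, h1, h2]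
    ring
  · rw [inv_N]
    simp [Jmat, Matrix.mul_apply, Fin.sum_univ_three, h1]
  · have hdet : IsUnit (N a).det := by simp [det_N]
    rw [Matrix.mul_assoc Jmat, Matrix.mul_assoc (N a), ← Matrix.mul_assoc Jmat, Jmat_mul_self,
      Matrix.one_mul, Matrix.mul_nonsing_inv_cancel_left _ _ hdet]
  · rw [inv_N]
    simp [Jmat, Matrix.mul_apply, Fin.sum_univ_three]
end

section
/- Let G = (g_{jk}) ∈ SU(2,1;ℤ[i]) with g_{13} ≠ 0. Then there exist a Gaussian integer γ with |γ|² even and an integer k such that the (1,3)-entry g'_{13} of the matrix G₁ = J · N_{(γ, ½|γ|² + i k)} · G satisfies |g'_{13}|² ≤ ½·|g_{13}|². -/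
open Matrix Complex

/-- The third column `(a, b, c)` of a matrix in `SU(2,1)` satisfies `|b|² = 2 Re (c * conj a)`. -/
theorem inSU21.normSq_eq {G : Matrix (Fin 3) (Fin 3) ℂ} (hG : inSU21 G) :
    normSq (G 1 2) = 2 * (G 2 2 * star (G 0 2)).re := by
  have h := congrArg Complex.re (congrFun (congrFun hG.1 2) 2)
  simp [Cmat, Matrix.mul_apply, Fin.sum_univ_three] at h
  simp [normSq_apply]
  linarith

theorem exists_int_sq_add_le (x : ℝ) : ∃ n : ℤ, ((n : ℝ) + x) ^ 2 ≤ 1 / 4 := by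
  refine ⟨round (-x), ?_⟩
  have h := abs_le.1 (abs_sub_round (-x))
  nlinarith [h.1, h.2]

/-- The Gaussian integers of even norm have covering radius at most `1`. -/
theorem exists_even_gaussianInt_normSq_add_le (w : ℂ) :
    ∃ γ : ℂ, IsGaussianInt γ ∧ (∃ t : ℤ, γ * star γ = 2 * (t : ℂ)) ∧ normSq (γ + w) ≤ 1 := by
  obtain ⟨p, hp⟩ := exists_int_sq_add_le ((w.re + w.im) / 2)
  obtain ⟨q, hq⟩ := exists_int_sq_add_le ((w.re - w.im) / 2)
  refine ⟨((p + q : ℤ) : ℂ) + ((p - q : ℤ) : ℂ) * I, ⟨_, _, rfl⟩, ⟨p ^ 2 + q ^ 2, ?_⟩, ?_⟩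
  · apply Complex.ext <;> simp [pow_two] <;> ring
  · simp [normSq_apply]
    nlinarith

/-- A point with `|w|² = 2 Re z` can be moved by a Heisenberg translation so that its last
coordinate has squared modulus at most `1 / 2`. -/
theorem exists_translation_normSq_le {w z : ℂ} (h : normSq w = 2 * z.re) :
    ∃ (γ : ℂ) (k : ℤ), IsGaussianInt γ ∧ (∃ t : ℤ, γ * star γ = 2 * (t : ℂ)) ∧
      normSq (γ * star γ / 2 + (k : ℂ) * I + star γ * w + z) ≤ 1 / 2 := by
  obtain ⟨γ, hγ, ht, hle⟩ := exists_even_gaussianInt_normSq_add_le w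
  obtain ⟨k, hk⟩ := exists_int_sq_add_le (star γ * w + z).im
  refine ⟨γ, k, hγ, ht, ?_⟩
  have hre : (γ * star γ / 2 + (k : ℂ) * I + star γ * w + z).re = normSq (γ + w) / 2 := by
    simp [normSq_apply] at h ⊢
    linarith
  have him : (γ * star γ / 2 + (k : ℂ) * I + star γ * w + z).im
      = k + (star γ * w + z).im := by
    simp
    ring
  rw [normSq_apply, hre, him]
  nlinarith [normSq_nonneg (γ + w)]

/-- The reduction step: for `G ∈ SU(2,1;ℤ[i])` with `g₁₃ ≠ 0` there is a Heisenberg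
translation in the Picard modular group after which the squared modulus of the
`(1,3)` entry is at most halved. -/
theorem reduction_step (G : Matrix (Fin 3) (Fin 3) ℂ) (hG : inSU21 G)
    (hZ : ∀ j k, IsGaussianInt (G j k)) (h13 : G 0 2 ≠ 0) :
    ∃ (γ : ℂ) (k : ℤ), IsGaussianInt γ ∧ (∃ t : ℤ, γ * star γ = 2 * (t : ℂ)) ∧
      Complex.normSq ((Jmat * N (γ, γ * star γ / 2 + (k : ℂ) * Complex.I) * G) 0 2)
        ≤ Complex.normSq (G 0 2) / 2 := by
  have hw : normSq (G 1 2 / G 0 2) = 2 * (G 2 2 / G 0 2).re := by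
    rw [normSq_div, hG.normSq_eq, div_eq_mul_inv (G 2 2), Complex.inv_def, ← mul_assoc,
      re_mul_ofReal, starRingEnd_apply]
    ring
  obtain ⟨γ, k, hγ, ht, hle⟩ := exists_translation_normSq_le hw
  refine ⟨γ, k, hγ, ht, ?_⟩
  have hentry : (Jmat * N (γ, γ * star γ / 2 + (k : ℂ) * I) * G) 0 2
      = -(G 0 2 * (γ * star γ / 2 + (k : ℂ) * I + star γ * (G 1 2 / G 0 2)
        + G 2 2 / G 0 2)) := by
    simp [Jmat, N, Matrix.mul_apply, Fin.sum_univ_three]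
    field_simp
    ring
  rw [hentry, normSq_neg, normSq_mul]
  linarith [mul_le_mul_of_nonneg_left hle (normSq_nonneg (G 0 2))]
end
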